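/- arXiv:1607.02636 — 3 statements merged into one kernel-verified Lean document; each statement's English description precedes it below -/
import Mathlib

section
/- Let X be a compact metric space equipped with its Borel σ-algebra and let μ be a probability measure on X. Then there exists a sequence (x_k) of points of X such that for every continuous function f : X → ℝ, the Cesàro averages of the values of f along the sequence converge to the integral of f, i.e. (1/(n+1)) · Σ_{k=0}^{n} f(x_k) → ∫_X f dμ as n → ∞. In other words, μ is the limit, in the vague (weak) topology, of the isobarycenters (1/(n+1)) · Σ_{k=0}^{n} δ_{x_k} of Dirac measures. -/
open MeasureTheory Filter Topology

/-- The strong law of large numbers along the i.i.d. sequence of coordinates of `ℕ → X`. -/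
theorem ae_tendsto_cesaro_infinitePi {X : Type*} [MeasurableSpace X]
    (μ : Measure X) [IsProbabilityMeasure μ] {f : X → ℝ} (hf : Measurable f)
    (hint : Integrable f μ) :
    ∀ᵐ x ∂(Measure.infinitePi fun _ : ℕ => μ),
      Tendsto (fun n : ℕ => (1 / (n + 1 : ℝ)) * ∑ k ∈ Finset.range (n + 1), f (x k))
        atTop (𝓝 (∫ a, f a ∂μ)) := by
  have hp (i : ℕ) := measurePreserving_eval_infinitePi (fun _ : ℕ => μ) i
  have hlaw := ProbabilityTheory.strong_law_ae_real
    (μ := Measure.infinitePi fun _ : ℕ => μ) (fun k x => f (x k))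
    ((hp 0).integrable_comp_of_integrable hint)
    (fun i j hij => (ProbabilityTheory.iIndepFun_infinitePi
      (P := fun _ : ℕ => μ) (X := fun _ => f) (fun _ => hf)).indepFun hij)
    (fun i => ProbabilityTheory.IdentDistrib.comp
      ⟨(hp i).measurable.aemeasurable, (hp 0).measurable.aemeasurable,
        (hp i).map_eq.trans (hp 0).map_eq.symm⟩ hf)
  filter_upwards [hlaw] with x hx
  have hmean : ∫ x : ℕ → X, f (x 0) ∂(Measure.infinitePi fun _ : ℕ => μ) = ∫ a, f a ∂μ := by
    have h := integral_map (μ := Measure.infinitePi fun _ : ℕ => μ) (f := f)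
      (hp 0).measurable.aemeasurable hf.aestronglyMeasurable
    rw [(hp 0).map_eq] at h
    exact h.symm
  rw [hmean] at hx
  refine (hx.comp (tendsto_add_atTop_nat 1)).congr fun n => ?_
  simp only [Function.comp_apply, Nat.cast_add, Nat.cast_one]
  ring

/-- A continuous function on a compact space is integrable for every finite Borel measure. -/
theorem ContinuousMap.integrable_of_compactSpace {X : Type*} [TopologicalSpace X] [CompactSpace X]
    [MeasurableSpace X] [BorelSpace X] (f : C(X, ℝ)) (μ : Measure X) [IsFiniteMeasure μ] :
    Integrable f μ :=
  .of_bound f.continuous.measurable.aestronglyMeasurable ‖f‖ (.of_forall f.norm_coe_le_norm)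

/-- The set of continuous functions whose Cesàro averages along a fixed sequence converge to
their integral is closed in the uniform norm. -/
theorem isClosed_setOf_tendsto_cesaro {X : Type*} [TopologicalSpace X] [CompactSpace X]
    [MeasurableSpace X] [BorelSpace X] (μ : Measure X) [IsProbabilityMeasure μ] (x : ℕ → X) :
    IsClosed {f : C(X, ℝ) |
      Tendsto (fun n : ℕ => (1 / (n + 1 : ℝ)) * ∑ k ∈ Finset.range (n + 1), f (x k))
        atTop (𝓝 (∫ a, f a ∂μ))} := by
  have hlip (n : ℕ) : LipschitzWith 1 fun f : C(X, ℝ) =>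
      (1 / (n + 1 : ℝ)) * ∑ k ∈ Finset.range (n + 1), f (x k) := by
    refine LipschitzWith.of_dist_le_mul fun f g => ?_
    have hsum : |∑ k ∈ Finset.range (n + 1), (f (x k) - g (x k))| ≤ (n + 1) * dist f g := by
      refine (Finset.abs_sum_le_sum_abs _ _).trans ?_
      refine (Finset.sum_le_card_nsmul _ _ (dist f g) fun k _ => ?_).trans_eq (by simp)
      exact f.dist_apply_le_dist (g := g) (x k)
    rw [Real.dist_eq, ← mul_sub, ← Finset.sum_sub_distrib, abs_mul, abs_of_pos (by positivity),
      NNReal.coe_one, one_mul, one_div, inv_mul_le_iff₀ (by positivity)]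
    exact hsum
  have hcont : Continuous fun f : C(X, ℝ) => ∫ a, f a ∂μ := by
    refine (LipschitzWith.of_dist_le_mul (K := 1) fun f g => ?_).continuous
    rw [dist_eq_norm, ← integral_sub (f.integrable_of_compactSpace μ) (g.integrable_of_compactSpace μ)]
    refine (norm_integral_le_of_norm_le_const
      (.of_forall fun a => f.dist_apply_le_dist (g := g) a)).trans_eq ?_
    simp
  exact (LipschitzWith.uniformEquicontinuous _ 1 hlip).equicontinuous
    |>.isClosed_setOfPred_tendsto hcont

/-- For every Borel probability measure `μ` on a compact metric space `X`, there exists a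
sequence `(x_k)` of points of `X` such that for every continuous `f : X → ℝ` the Cesàro
averages `(1/(n+1)) ∑_{k=0}^n f (x_k)` converge to `∫_X f dμ`; i.e. `μ` is the vague limit
of the isobarycenters of the Dirac measures `δ_{x_k}`. -/
theorem monte_carlo_dirac_approximation
    {X : Type*} [MetricSpace X] [CompactSpace X]
    [MeasurableSpace X] [BorelSpace X]
    (μ : Measure X) [IsProbabilityMeasure μ] :
    ∃ x : ℕ → X, ∀ f : C(X, ℝ),
      Tendsto (fun n : ℕ => (1 / (n + 1 : ℝ)) * ∑ k ∈ Finset.range (n + 1), f (x k))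
        atTop (𝓝 (∫ a, f a ∂μ)) := by
  obtain ⟨s, hs, hdense⟩ := TopologicalSpace.exists_countable_dense C(X, ℝ)
  have hae := (ae_ball_iff hs).2 fun f _ =>
    ae_tendsto_cesaro_infinitePi μ f.continuous.measurable
      (f.integrable_of_compactSpace μ)
  obtain ⟨x, hx⟩ := hae.exists
  exact ⟨x, fun f => (isClosed_setOf_tendsto_cesaro μ x).closure_subset_iff.2 hx (hdense f)⟩
end

section
/- Let X be a compact metric space equipped with its Borel σ-algebra. A probability measure μ on X is an extreme point of the convex set of probability measures if and only if it is a Dirac measure. Precisely: (for all probability measures μ₁, μ₂ on X and all real a with 0 < a < 1, if μ = a·μ₁ + (1−a)·μ₂ then μ₁ = μ₂) holds if and only if there exists x ∈ X with μ = δ_x. -/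
open MeasureTheory

/-- A probability measure that gives full mass to the point `x` is the Dirac measure at `x`. -/
theorem eq_dirac_of_measure_singleton_compl_eq_zero {X : Type*} [MeasurableSpace X]
    {ν : Measure X} [IsProbabilityMeasure ν] {x : X} (h : ν {x}ᶜ = 0) :
    ν = Measure.dirac x := by
  have hae : ∀ᵐ y ∂ν, y = x := h
  ext s hs
  by_cases hx : x ∈ s
  · rw [Measure.dirac_apply_of_mem hx, ← measure_univ (μ := ν)]
    refine measure_congr ?_
    filter_upwards [hae] with y hy
    exact propext ⟨fun _ => trivial, fun _ => hy ▸ hx⟩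
  · rw [Measure.dirac_apply' x hs, Set.indicator_of_notMem hx]
    exact measure_mono_null (fun y hy (hyx : y = x) => hx (hyx ▸ hy)) h

/-- A probability measure is the convex combination of its conditionings on a set of nontrivial
measure and on the complement of that set. -/
theorem eq_ofReal_smul_cond_add_cond_compl {X : Type*} [MeasurableSpace X]
    (μ : Measure X) [IsProbabilityMeasure μ] {s : Set X} (hs : MeasurableSet s)
    (h₀ : μ s ≠ 0) (h₀' : μ sᶜ ≠ 0) :
    μ = ENNReal.ofReal (μ.real s) • ProbabilityTheory.cond μ s +
      ENNReal.ofReal (1 - μ.real s) • ProbabilityTheory.cond μ sᶜ := by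
  rw [← probReal_compl_eq_one_sub hs, ofReal_measureReal, ofReal_measureReal,
    ProbabilityTheory.cond, ProbabilityTheory.cond, smul_smul, smul_smul,
    ENNReal.mul_inv_cancel h₀ (measure_ne_top _ _),
    ENNReal.mul_inv_cancel h₀' (measure_ne_top _ _), one_smul, one_smul,
    Measure.restrict_add_restrict_compl hs]

/-- On a compact metric space `X` with its Borel σ-algebra, a probability measure `μ` is an
extreme point of the convex set of probability measures (no nontrivial convex decomposition
`μ = a•μ₁ + (1-a)•μ₂` with `0 < a < 1` has `μ₁ ≠ μ₂`) if and only if `μ` is a Dirac measure. -/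
theorem extreme_probability_measure_iff_dirac
    {X : Type*} [MetricSpace X] [CompactSpace X]
    [MeasurableSpace X] [BorelSpace X]
    (μ : Measure X) [IsProbabilityMeasure μ] :
    (∀ (μ₁ μ₂ : Measure X), IsProbabilityMeasure μ₁ → IsProbabilityMeasure μ₂ →
        ∀ a : ℝ, 0 < a → a < 1 →
          μ = ENNReal.ofReal a • μ₁ + ENNReal.ofReal (1 - a) • μ₂ → μ₁ = μ₂)
      ↔ ∃ x : X, μ = Measure.dirac x := by
  constructor
  · intro h
    have hzo : IsZeroOneMeasure μ := by
      refine ⟨fun s hs => ?_⟩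
      by_contra! hne
      obtain ⟨h₀, h₁⟩ := hne
      have h₀' : μ sᶜ ≠ 0 := fun hc => h₁ ((prob_compl_eq_zero_iff hs).1 hc)
      have hpos : 0 < μ.real s := ENNReal.toReal_pos h₀ (measure_ne_top _ _)
      have hpos' : 0 < μ.real sᶜ := ENNReal.toReal_pos h₀' (measure_ne_top _ _)
      rw [probReal_compl_eq_one_sub hs] at hpos'
      have heq := h _ _ (ProbabilityTheory.cond_isProbabilityMeasure h₀)
        (ProbabilityTheory.cond_isProbabilityMeasure h₀') (μ.real s) hpos (by linarith)
        (eq_ofReal_smul_cond_add_cond_compl μ hs h₀ h₀')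
      have hval := congrArg (fun ν : Measure X => ν s) heq
      simp [ProbabilityTheory.cond_apply_self h₀ (measure_ne_top μ s),
        ProbabilityTheory.cond_apply hs.compl] at hval
    exact IsZeroOneMeasure.exists_eq_dirac
  · rintro ⟨x, rfl⟩ μ₁ μ₂ _ _ a ha ha' h
    have hnull : ENNReal.ofReal a * μ₁ {x}ᶜ + ENNReal.ofReal (1 - a) * μ₂ {x}ᶜ = 0 := by
      have hval := congrArg (fun ν : Measure X => ν {x}ᶜ) h
      simpa [Measure.dirac_apply' x (measurableSet_singleton x).compl] using hval.symm
    rw [add_eq_zero, mul_eq_zero, mul_eq_zero, ENNReal.ofReal_eq_zero,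
      ENNReal.ofReal_eq_zero] at hnull
    rw [eq_dirac_of_measure_singleton_compl_eq_zero (hnull.1.resolve_left (by linarith)),
      eq_dirac_of_measure_singleton_compl_eq_zero (hnull.2.resolve_left (by linarith))]
end

section
/- Let E be a real normed vector space and let x, y ∈ E. There exists a map Γ : ℝ → (ℕ → E) such that: (i) for every n ∈ ℕ, the map t ↦ Γ(t)_n is infinitely differentiable (C^∞) from ℝ to E; (ii) for every t ∈ ℝ, the sequence n ↦ Γ(t)_n is eventually constant (in particular it is a Cauchy sequence and converges); (iii) Γ(0)_n = x for all n, so lim_{n→∞} Γ(0)_n = x; (iv) for every t > 0, lim_{n→∞} Γ(t)_n = y. Consequently, if x ≠ y, the pointwise-limit function t ↦ lim_{n→∞} Γ(t)_n is not continuous at t = 0 (hence not smooth). This shows that the limit map from the space of Cauchy sequences with the product (coordinatewise) diffeology to E is not smooth whenever two distinct points of E are joined by a smooth path. -/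
open Filter Topology

/-- For fixed `t`, the rescaled smooth transitions `Real.smoothTransition (n * t)` are eventually
equal to the indicator of `0 < t`. -/
lemma exists_forall_ge_smoothTransition_natCast_mul_eq (t : ℝ) :
    ∃ N : ℕ, ∀ n ≥ N, Real.smoothTransition (n * t) = if 0 < t then 1 else 0 := by
  split_ifs with ht
  · obtain ⟨N, hN⟩ := exists_nat_ge t⁻¹
    refine ⟨N, fun n hn => Real.smoothTransition.one_of_one_le ?_⟩
    rw [← inv_le_iff_one_le_mul₀ ht]
    exact hN.trans (Nat.cast_le.2 hn)
  · exact ⟨0, fun n _ => Real.smoothTransition.zero_of_nonpos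
      (mul_nonpos_of_nonneg_of_nonpos n.cast_nonneg (not_lt.1 ht))⟩

/-- A function which is constantly `y` on the positive reals and continuous at `0` takes the
value `y` at `0`. -/
lemma ContinuousAt.eq_of_forall_pos_eq {X : Type*} [TopologicalSpace X] [T2Space X] {f : ℝ → X}
    {y : X} (hf : ContinuousAt f 0) (h : ∀ t, 0 < t → f t = y) : f 0 = y :=
  tendsto_nhds_unique (hf.tendsto.mono_left (nhdsWithin_le_nhds (s := Set.Ioi 0)))
    (tendsto_const_nhds.congr' (eventually_mem_nhdsWithin.mono fun t ht => (h t ht).symm))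

/-- In a real normed vector space `E`, for any `x y : E` there is a map `Γ : ℝ → (ℕ → E)`
such that: (i) each coordinate `t ↦ Γ t n` is `C^∞`; (ii) for every `t` the sequence
`n ↦ Γ t n` is eventually constant (hence Cauchy and convergent, with limit `L t`);
(iii) `Γ 0 n = x` for all `n`; (iv) for every `t > 0` the limit is `y`.  Consequently, if
`x ≠ y`, the pointwise-limit function `L` is not continuous at `0` (hence not smooth):
the limit map on Cauchy sequences with the product diffeology is not smooth. -/
theorem limit_not_smooth_for_product_diffeology
    {E : Type*} [NormedAddCommGroup E] [NormedSpace ℝ E] (x y : E) :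
    ∃ (Γ : ℝ → ℕ → E) (L : ℝ → E),
      (∀ n : ℕ, ContDiff ℝ (⊤ : ℕ∞) (fun t : ℝ => Γ t n)) ∧
      (∀ t : ℝ, ∃ N : ℕ, ∀ n ≥ N, Γ t n = Γ t N) ∧
      (∀ n : ℕ, Γ 0 n = x) ∧
      (∀ t : ℝ, Tendsto (fun n : ℕ => Γ t n) atTop (𝓝 (L t))) ∧
      (∀ t : ℝ, 0 < t → L t = y) ∧
      (x ≠ y → ¬ ContinuousAt L 0) := by
  have key : ∀ t : ℝ, ∃ N : ℕ, ∀ n ≥ N,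
      x + Real.smoothTransition (n * t) • (y - x) = if 0 < t then y else x := by
    intro t
    obtain ⟨N, hN⟩ := exists_forall_ge_smoothTransition_natCast_mul_eq t
    refine ⟨N, fun n hn => ?_⟩
    rw [hN n hn]
    split_ifs <;> simp
  have hpos : ∀ t : ℝ, 0 < t → (if 0 < t then y else x) = y := fun t ht => if_pos ht
  refine ⟨fun t n => x + Real.smoothTransition (n * t) • (y - x), fun t => if 0 < t then y else x,
    fun n => ?_, fun t => ?_, fun n => by simp, fun t => ?_, hpos, fun hxy hL => hxy ?_⟩
  · exact contDiff_const.add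
      ((Real.smoothTransition.contDiff.comp (contDiff_const.mul contDiff_id)).smul contDiff_const)
  · obtain ⟨N, hN⟩ := key t
    exact ⟨N, fun n hn => (hN n hn).trans (hN N le_rfl).symm⟩
  · obtain ⟨N, hN⟩ := key t
    exact tendsto_const_nhds.congr' (eventually_atTop.2 ⟨N, fun n hn => (hN n hn).symm⟩)
  · simpa using hL.eq_of_forall_pos_eq hpos
end
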